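/- arXiv:2503.01026 — 2 statements merged into one kernel-verified Lean document; each statement's English description precedes it below -/
import Mathlib

section
/- The Narayana word n is 3-balanced: for any two factors x, y of n of equal length and any letter a ∈ {0,1,2}, | |x|_a − |y|_a | ≤ 3. Moreover n is not 2-balanced. -/
def nu : Fin 3 → List (Fin 3) := fun a => if a = 0 then [0, 1] else if a = 1 then [2] else [0]

def nuPow (k : ℕ) : List (Fin 3) := (fun w => w.flatMap nu)^[k] [0]


def nword (i : ℕ) : Fin 3 := (nuPow (i+2)).getD i 0


def IsFactor (x : List (Fin 3)) : Prop :=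
  ∃ i, x = (List.range x.length).map (fun k => nword (i + k))

/-- The word is `k`-balanced. -/
def NBalanced (k : ℕ) : Prop :=
  ∀ x y : List (Fin 3), IsFactor x → IsFactor y → x.length = y.length →
    ∀ a : Fin 3, ((x.count a : ℤ) - (y.count a : ℤ)).natAbs ≤ k

theorem nuPow_succ (k : ℕ) : nuPow (k + 1) = (nuPow k).flatMap nu :=
  Function.iterate_succ_apply' _ _ _

theorem nuPow_add_three (k : ℕ) : nuPow (k + 3) = nuPow (k + 2) ++ nuPow k := by
  induction k with
  | zero => decide
  | succ k ih => rw [nuPow_succ (k + 3), ih, List.flatMap_append, ← nuPow_succ, ← nuPow_succ, ← ih]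

theorem nuPow_prefix_succ (k : ℕ) : nuPow k <+: nuPow (k + 1) := by
  match k with
  | 0 => decide
  | 1 => decide
  | k + 2 => exact nuPow_add_three k ▸ List.prefix_append _ _

theorem nuPow_prefix {j k : ℕ} (h : j ≤ k) : nuPow j <+: nuPow k := by
  induction k, h using Nat.le_induction with
  | base => exact List.prefix_rfl
  | succ k _ ih => exact ih.trans (nuPow_prefix_succ k)

theorem lt_length_nuPow (k : ℕ) : k < (nuPow k).length := by
  match k with
  | 0 => decide
  | 1 => decide
  | 2 => decide
  | k + 3 =>
    have h₂ := lt_length_nuPow (k + 2)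
    have h₀ := lt_length_nuPow k
    rw [nuPow_add_three, List.length_append]
    omega

theorem nword_eq_getD {i k : ℕ} (h : i < (nuPow k).length) : nword i = (nuPow k).getD i 0 := by
  have h' : i < (nuPow (i + 2)).length := by have := lt_length_nuPow (i + 2); omega
  unfold nword
  rw [List.getD_eq_getElem _ _ h, List.getD_eq_getElem _ _ h']
  rcases le_total (i + 2) k with hk | hk
  · exact (nuPow_prefix hk).getElem h'
  · exact ((nuPow_prefix hk).getElem h).symm

theorem map_nword_range_prefix (n : ℕ) : (List.range n).map nword <+: nuPow n := by
  rw [List.prefix_iff_eq_take]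
  have hn := lt_length_nuPow n
  refine List.ext_getElem (by simp; omega) fun i hi _ => ?_
  have hi' : i < (nuPow n).length := by simp at hi; omega
  simp [nword_eq_getD hi', List.getElem?_eq_getElem hi']

theorem IsFactor.exists_append {x : List (Fin 3)} (hx : IsFactor x) :
    ∃ i j, (List.range j).map nword = (List.range i).map nword ++ x := by
  obtain ⟨i, hi⟩ := hx
  refine ⟨i, i + x.length, ?_⟩
  conv_rhs => rw [hi]
  simp [List.range_add, Function.comp_def]

theorem List.prefix_append_cases {α : Type*} {p A B : List α} (h : p <+: A ++ B) :
    p <+: A ∨ ∃ t, p = A ++ t ∧ t <+: B := by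
  rcases List.prefix_or_prefix_of_prefix h (List.prefix_append A B) with h' | ⟨t, rfl⟩
  · exact Or.inl h'
  · exact Or.inr ⟨t, rfl, (List.prefix_append_right_inj A).1 h⟩

/-- The total weight of a word. -/
def weight {M : Type*} [AddMonoid M] (w : Fin 3 → M) (x : List (Fin 3)) : M := (x.map w).sum

theorem weight_append {M : Type*} [AddMonoid M] (w : Fin 3 → M) (x y : List (Fin 3)) :
    weight w (x ++ y) = weight w x + weight w y := by
  simp [weight]

theorem weight_indicator_sub (f : ℝ) (a : Fin 3) (x : List (Fin 3)) :
    weight (fun b => (if b = a then 1 else 0) - f) x = x.count a - f * x.length := by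
  induction x with
  | nil => simp [weight]
  | cons b x ih =>
    have : weight (fun b => (if b = a then 1 else 0) - f) (b :: x) =
        ((if b = a then 1 else 0) - f) + weight (fun b => (if b = a then 1 else 0) - f) x := by
      simp [weight]
    rw [this, ih, List.count_cons]
    by_cases h : b = a <;> simp [h] <;> ring

/-- Consecutive weights of the words `nuPow k`, and of their heaviest prefixes. -/
def prefixMaxState (z : Fin 3 → ℤ) : ℕ → (ℤ × ℤ × ℤ) × (ℤ × ℤ × ℤ)
  | 0 => ((z 0, z 0 + z 1, z 0 + z 1 + z 2),
      (max 0 (z 0), max (max 0 (z 0)) (z 0 + z 1),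
        max (max (max 0 (z 0)) (z 0 + z 1)) (z 0 + z 1 + z 2)))
  | k + 1 =>
    let s := prefixMaxState z k
    ((s.1.2.1, s.1.2.2, s.1.2.2 + s.1.1),
      (s.2.2.1, s.2.2.2, max s.2.2.2 (s.1.2.2 + s.2.1)))

theorem prefixMaxState_weight (z : Fin 3 → ℤ) (k : ℕ) :
    (prefixMaxState z k).1 =
      (weight z (nuPow k), weight z (nuPow (k + 1)), weight z (nuPow (k + 2))) := by
  induction k with
  | zero =>
    simp [prefixMaxState, weight, nuPow, nu, add_assoc]
  | succ k ih =>
    simp [prefixMaxState, ih, nuPow_add_three, weight_append]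

theorem prefix_weight_le (z : Fin 3 → ℤ) (k : ℕ) :
    (∀ p, p <+: nuPow k → weight z p ≤ (prefixMaxState z k).2.1) ∧
    (∀ p, p <+: nuPow (k + 1) → weight z p ≤ (prefixMaxState z k).2.2.1) ∧
    (∀ p, p <+: nuPow (k + 2) → weight z p ≤ (prefixMaxState z k).2.2.2) := by
  induction k with
  | zero =>
    have h0 : nuPow 0 = [0] := rfl
    have h1 : nuPow 1 = [0, 1] := rfl
    have h2 : nuPow 2 = [0, 1, 2] := rfl
    simp only [zero_add, h0, h1, h2]
    refine ⟨?_, ?_, ?_⟩ <;> intro p hp <;> rw [← List.mem_inits] at hp <;> simp at hp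
    · rcases hp with rfl | rfl <;> simp [prefixMaxState, weight]
    · rcases hp with rfl | rfl | rfl <;> simp [prefixMaxState, weight]
    · rcases hp with rfl | rfl | rfl | rfl <;> simp [prefixMaxState, weight, add_assoc]
  | succ k ih =>
    obtain ⟨h0, h1, h2⟩ := ih
    refine ⟨h1, h2, fun p hp => ?_⟩
    rw [show k + 1 + 2 = k + 3 from rfl, nuPow_add_three] at hp
    rcases List.prefix_append_cases hp with hp | ⟨t, rfl, ht⟩
    · exact le_max_of_le_left (h2 p hp)
    · refine le_max_of_le_right ?_
      rw [weight_append, prefixMaxState_weight]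
      exact add_le_add_right (h0 t ht) _

theorem prefix_weight_le_add_tail {w : Fin 3 → ℝ} {K : ℕ} {B C r : ℝ} (hr : 0 ≤ r) (hr1 : r < 1)
    (hC : 0 ≤ C) (hc : ∀ k, |weight w (nuPow k)| ≤ C * r ^ k) (hK : 2 ≤ K)
    (hB : ∀ p, p <+: nuPow K → weight w p ≤ B) {k : ℕ} (hk : K ≤ k) :
    ∀ p, p <+: nuPow k → weight w p ≤ B + C / (1 - r) * (r ^ K - r ^ k) := by
  have h1r : 0 < 1 - r := by linarith
  induction k, hk using Nat.le_induction with
  | base => simpa using hB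
  | succ k hk ih =>
    have hstep : C / (1 - r) * (r ^ K - r ^ (k + 1)) =
        C / (1 - r) * (r ^ K - r ^ k) + C * r ^ k := by
      field_simp
      ring
    have hpos : 0 ≤ C * r ^ k := by positivity
    intro p hp
    obtain ⟨j, rfl⟩ : ∃ j, k = j + 2 := ⟨k - 2, by omega⟩
    rw [show j + 2 + 1 = j + 3 from rfl, nuPow_add_three] at hp
    rw [hstep]
    rcases List.prefix_append_cases hp with hp | ⟨t, rfl, ht⟩
    · linarith [ih p hp]
    · rw [weight_append]
      linarith [ih t (ht.trans (nuPow_prefix (by omega))), (abs_le.1 (hc (j + 2))).2]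

theorem weight_nuPow_contracting {β : ℝ} (hβ : β ^ 3 = β ^ 2 + 1) {w : Fin 3 → ℝ}
    (hw : β ^ 2 * w 0 + β * w 1 + w 2 = 0) (k : ℕ) :
    weight w (nuPow (k + 2)) + (β - 1) * weight w (nuPow (k + 1)) +
      (β ^ 2 - β) * weight w (nuPow k) = 0 := by
  induction k with
  | zero =>
    simp [weight, nuPow, nu]
    linear_combination hw
  | succ k ih =>
    rw [show k + 1 + 2 = k + 3 from rfl, nuPow_add_three, weight_append]
    linear_combination β * ih - weight w (nuPow k) * hβ

theorem abs_weight_nuPow_le {β : ℝ} (hβ : β ^ 3 = β ^ 2 + 1) (hlo : 14655712318 / 10 ^ 10 ≤ β)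
    (hhi : β ≤ 14655712319 / 10 ^ 10) {w : Fin 3 → ℝ} (hw : β ^ 2 * w 0 + β * w 1 + w 2 = 0)
    (h0 : |w 0| ≤ 54 / 100) (h1 : |w 0 + w 1| ≤ 44 / 100) (k : ℕ) :
    |weight w (nuPow k)| ≤ 9 / 10 * (83 / 100) ^ k := by
  have hinv_lo : 68 / 100 ≤ β ^ 2 - β := by nlinarith
  have hinv_hi : β ^ 2 - β ≤ 683 / 1000 := by nlinarith
  have hQ : ∀ k, weight w (nuPow (k + 1)) ^ 2 +
      (β - 1) * weight w (nuPow k) * weight w (nuPow (k + 1)) +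
      (β ^ 2 - β) * weight w (nuPow k) ^ 2 ≤ 504 / 1000 * ((83 / 100) ^ 2) ^ k := by
    intro k
    induction k with
    | zero =>
      have e0 : weight w (nuPow 0) = w 0 := by simp [weight, nuPow]
      have e1 : weight w (nuPow (0 + 1)) = w 0 + w 1 := by simp [weight, nuPow, nu]
      rw [e0, e1, pow_zero, mul_one]
      have s0 : w 0 ^ 2 ≤ (54 / 100) ^ 2 := sq_le_sq' (abs_le.1 h0).1 (abs_le.1 h0).2
      have s1 : (w 0 + w 1) ^ 2 ≤ (44 / 100) ^ 2 := sq_le_sq' (abs_le.1 h1).1 (abs_le.1 h1).2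
      have s01 : w 0 * (w 0 + w 1) ≤ 54 / 100 * (44 / 100) :=
        (le_abs_self _).trans (abs_mul (w 0) _ ▸ mul_le_mul h0 h1 (abs_nonneg _) (by norm_num))
      have t01 : (β - 1) * (w 0 * (w 0 + w 1)) ≤ (β - 1) * (54 / 100 * (44 / 100)) :=
        mul_le_mul_of_nonneg_left s01 (by linarith)
      have t0 : (β ^ 2 - β) * w 0 ^ 2 ≤ (683 / 1000) * (54 / 100) ^ 2 :=
        mul_le_mul hinv_hi s0 (sq_nonneg _) (by norm_num)
      nlinarith
    | succ k ih =>
      have hrec := weight_nuPow_contracting hβ hw k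
      rw [show k + 1 + 1 = k + 2 from rfl, pow_succ (_ ^ 2) k]
      generalize weight w (nuPow k) = x at *
      generalize weight w (nuPow (k + 1)) = y at *
      have hk : weight w (nuPow (k + 2)) = -((β - 1) * y + (β ^ 2 - β) * x) := by linarith
      rw [hk]
      have hpos : 0 ≤ (504 / 1000 * ((83 / 100) ^ 2) ^ k : ℝ) := by positivity
      calc _ = (β ^ 2 - β) * (y ^ 2 + (β - 1) * x * y + (β ^ 2 - β) * x ^ 2) := by ring
        _ ≤ (β ^ 2 - β) * (504 / 1000 * ((83 / 100) ^ 2) ^ k) :=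
          mul_le_mul_of_nonneg_left ih (by linarith)
        _ ≤ _ := by nlinarith
  refine abs_le_of_sq_le_sq ?_ (by positivity)
  have h := hQ k
  generalize weight w (nuPow k) = x at *
  generalize weight w (nuPow (k + 1)) = y at *
  rw [mul_pow, ← pow_mul, mul_comm k 2, pow_mul]
  have hdisc : (β - 1) ^ 2 ≤ 22 / 100 := by nlinarith
  nlinarith [sq_nonneg (y + (β - 1) / 2 * x), mul_le_mul_of_nonneg_right hdisc (sq_nonneg x),
    mul_le_mul_of_nonneg_right hinv_lo (sq_nonneg x),
    show (0 : ℝ) < ((83 / 100) ^ 2) ^ k by positivity]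

theorem weight_mono {w z : Fin 3 → ℝ} (h : ∀ b, w b ≤ z b) (x : List (Fin 3)) :
    weight w x ≤ weight z x :=
  List.sum_le_sum fun b _ => h b

theorem weight_intCast_div (z : Fin 3 → ℤ) (q : ℝ) (x : List (Fin 3)) :
    weight (fun b => (z b : ℝ) / q) x = (weight z x : ℤ) / q := by
  induction x with
  | nil => simp [weight]
  | cons b x ih =>
    have h : weight (fun b => (z b : ℝ) / q) (b :: x) =
      (z b : ℝ) / q + weight (fun b => (z b : ℝ) / q) x := by simp [weight]
    have h' : weight z (b :: x) = z b + weight z x := by simp [weight]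
    rw [h, h', ih]
    push_cast
    ring

theorem weight_prefix_nword_le {β : ℝ} (hβ : β ^ 3 = β ^ 2 + 1)
    (hlo : 14655712318 / 10 ^ 10 ≤ β) (hhi : β ≤ 14655712319 / 10 ^ 10) {w : Fin 3 → ℝ}
    (hw : β ^ 2 * w 0 + β * w 1 + w 2 = 0)
    (h0 : |w 0| ≤ 54 / 100) (h1 : |w 0 + w 1| ≤ 44 / 100) {z : Fin 3 → ℤ}
    (hz : ∀ b, w b ≤ z b / 10 ^ 8) {B : ℤ} (hB : (prefixMaxState z 28).2.1 ≤ B) (n : ℕ) :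
    weight w ((List.range n).map nword) ≤ B / 10 ^ 8 + 3 / 100 := by
  have hbase : ∀ p, p <+: nuPow 28 → weight w p ≤ B / 10 ^ 8 := fun p hp => by
    refine (weight_mono hz p).trans ?_
    rw [weight_intCast_div]
    have : weight z p ≤ B := ((prefix_weight_le z 28).1 p hp).trans hB
    gcongr
  have hpre : (List.range n).map nword <+: nuPow (n + 28) :=
    (map_nword_range_prefix n).trans (nuPow_prefix (by omega))
  refine (prefix_weight_le_add_tail (by norm_num) (by norm_num) (by norm_num)
    (abs_weight_nuPow_le hβ hlo hhi hw h0 h1) (by norm_num) hbase (by omega) _ hpre).trans ?_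
  have : (0 : ℝ) < (83 / 100) ^ (n + 28) := by positivity
  have h28 : (9 / 10 / (1 - 83 / 100) * (83 / 100) ^ 28 : ℝ) ≤ 3 / 100 := by norm_num
  nlinarith

theorem exists_narayana_root :
    ∃ β : ℝ, β ^ 3 = β ^ 2 + 1 ∧ 14655712318 / 10 ^ 10 ≤ β ∧ β ≤ 14655712319 / 10 ^ 10 := by
  have hc : ContinuousOn (fun x : ℝ => x ^ 3 - x ^ 2)
      (Set.Icc (14655712318 / 10 ^ 10) (14655712319 / 10 ^ 10)) := by fun_prop
  obtain ⟨β, hβ, h⟩ := intermediate_value_Icc (by norm_num) hc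
    (show (1 : ℝ) ∈ Set.Icc _ _ by constructor <;> norm_num)
  exact ⟨β, by simp only at h; linarith, hβ.1, hβ.2⟩

/-- The discrepancy of each letter over prefixes ranges in an interval of length less than 2. -/
theorem exists_discrepancy_bound (a : Fin 3) : ∃ f L U : ℝ, U - L < 2 ∧ ∀ n,
    L ≤ weight (fun b => (if b = a then 1 else 0) - f) ((List.range n).map nword) ∧
    weight (fun b => (if b = a then 1 else 0) - f) ((List.range n).map nword) ≤ U := by
  obtain ⟨β, hβ, hlo, hhi⟩ := exists_narayana_root
  have hsq_lo : 2147899035 / 10 ^ 9 ≤ β ^ 2 := by nlinarith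
  have hsq_hi : β ^ 2 ≤ 2147899037 / 10 ^ 9 := by nlinarith
  suffices H : ∀ (f : ℝ) (zp zn : Fin 3 → ℤ) (Bp Bn : ℤ),
      (β ^ 2 * ((if 0 = a then 1 else 0) - f) + β * ((if 1 = a then 1 else 0) - f) +
        ((if 2 = a then 1 else 0) - f) = 0) →
      |(if 0 = a then 1 else 0) - f| ≤ 54 / 100 →
      |((if 0 = a then 1 else 0) - f) + ((if 1 = a then 1 else 0) - f)| ≤ 44 / 100 →
      (∀ b, (if b = a then 1 else 0) - f ≤ zp b / 10 ^ 8) →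
      (∀ b, -((if b = a then 1 else 0) - f) ≤ zn b / 10 ^ 8) →
      (prefixMaxState zp 28).2.1 ≤ Bp → (prefixMaxState zn 28).2.1 ≤ Bn →
      (Bp + Bn : ℝ) / 10 ^ 8 < 194 / 100 → ∃ f L U : ℝ, U - L < 2 ∧ ∀ n,
      L ≤ weight (fun b => (if b = a then 1 else 0) - f) ((List.range n).map nword) ∧
      weight (fun b => (if b = a then 1 else 0) - f) ((List.range n).map nword) ≤ U by
    fin_cases a
    · refine H (β - 1) ![53442877, -46557123, -46557123] ![-53442876, 46557124, 46557124]
        104000000 79000000 ?_ ?_ ?_ ?_ ?_ (by decide +kernel) (by decide +kernel) (by norm_num)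
      · simp; linear_combination -hβ
      · simp [abs_le]; constructor <;> linarith
      · simp [abs_le]; constructor <;> linarith
      · intro b; fin_cases b <;> simp <;> linarith
      · intro b; fin_cases b <;> simp <;> linarith
    · refine H (1 + β - β ^ 2) ![-31767219, 68232781, -31767219] ![31767220, -68232780, 31767220]
        72000000 86000000 ?_ ?_ ?_ ?_ ?_ (by decide +kernel) (by decide +kernel) (by norm_num)
      · simp; linear_combination (1 + β) * hβ
      · simp [abs_le]; constructor <;> linarith
      · simp [abs_le]; constructor <;> linarith
      · intro b; fin_cases b <;> simp <;> linarith
      · intro b; fin_cases b <;> simp <;> linarith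
    · refine H (β ^ 2 - 2 * β + 1) ![-21675657, -21675657, 78324343]
        ![21675658, 21675658, -78324342]
        76000000 102000000 ?_ ?_ ?_ ?_ ?_ (by decide +kernel) (by decide +kernel) (by norm_num)
      · simp; linear_combination (-β) * hβ
      · simp [abs_le]; constructor <;> linarith
      · simp [abs_le]; constructor <;> linarith
      · intro b; fin_cases b <;> simp <;> linarith
      · intro b; fin_cases b <;> simp <;> linarith
  intro f zp zn Bp Bn hw h0 h1 hp hn hBp hBn hB
  refine ⟨f, -(Bn / 10 ^ 8 + 3 / 100), Bp / 10 ^ 8 + 3 / 100, by linarith, fun n => ⟨?_, ?_⟩⟩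
  · have h := weight_prefix_nword_le hβ hlo hhi
      (w := fun b => -((if b = a then 1 else 0) - f)) (by linear_combination -hw)
      (by rwa [abs_neg]) (by rwa [← neg_add, abs_neg]) hn hBn n
    have hneg : weight (fun b => -((if b = a then 1 else 0) - f)) ((List.range n).map nword) =
        -weight (fun b => (if b = a then 1 else 0) - f) ((List.range n).map nword) := by
      simp only [weight, List.sum_neg, List.map_map]
      rfl
    linarith
  · exact weight_prefix_nword_le hβ hlo hhi hw h0 h1 hp hBp n

theorem nBalanced_three : NBalanced 3 := by
  intro x y hx hy hxy a
  obtain ⟨f, L, U, hLU, hD⟩ := exists_discrepancy_bound a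
  obtain ⟨i, j, hi⟩ := hx.exists_append
  obtain ⟨k, l, hk⟩ := hy.exists_append
  have hxw := congrArg (weight fun b => (if b = a then 1 else 0) - f) hi
  have hyw := congrArg (weight fun b => (if b = a then 1 else 0) - f) hk
  rw [weight_append, weight_indicator_sub f a x] at hxw
  rw [weight_append, weight_indicator_sub f a y, ← hxy] at hyw
  have h1 : ((x.count a : ℤ) - (y.count a : ℤ) : ℝ) < 4 := by
    push_cast
    linarith [(hD i).1, (hD j).2, (hD k).2, (hD l).1]
  have h2 : (-4 : ℝ) < ((x.count a : ℤ) - (y.count a : ℤ) : ℝ) := by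
    push_cast
    linarith [(hD i).2, (hD j).1, (hD k).1, (hD l).2]
  have h1' : (x.count a : ℤ) - (y.count a : ℤ) < 4 := by exact_mod_cast h1
  have h2' : -4 < (x.count a : ℤ) - (y.count a : ℤ) := by exact_mod_cast h2
  omega

theorem isFactor_map_range_getD {i n k : ℕ} (h : i + n ≤ (nuPow k).length) :
    IsFactor ((List.range n).map fun j => (nuPow k).getD (i + j) 0) := by
  refine ⟨i, ?_⟩
  rw [List.length_map, List.length_range]
  refine List.map_congr_left fun j hj => ?_
  rw [List.mem_range] at hj
  exact (nword_eq_getD (by omega)).symm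

theorem not_nBalanced_two : ¬ NBalanced 2 := by
  intro h
  have h12 : IsFactor _ := isFactor_map_range_getD (i := 12) (n := 14) (k := 9) (by decide +kernel)
  have h26 : IsFactor _ := isFactor_map_range_getD (i := 26) (n := 14) (k := 9) (by decide +kernel)
  exact absurd (h _ _ h12 h26 (by simp) 0) (by decide +kernel)

theorem narayana_balance : NBalanced 3 ∧ ¬ NBalanced 2 :=
  ⟨nBalanced_three, not_nBalanced_two⟩
end

section
/- For all i ≥ 0, H(i) − ⌊i/α⌋ ∈ {0, 1}, where H is the Hofstadter H-sequence defined by H(0) = 0 and H(i) = i − H(H(H(i−1))), and α is the real root of X³ = X² + 1 (Cloitre's conjecture). -/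
namespace HofstadterH

/-- The linear form `b - τ * a` evaluated at the `j`-th iterate of `(a, b, c) ↦ (a + c, a, b)`. -/
def discrepancy (τ : ℝ) : ℕ → ℝ → ℝ → ℝ → ℝ
  | 0, a, b, _ => b - τ * a
  | j + 1, a, b, c => discrepancy τ j (a + c) a b

lemma discrepancy_add (τ : ℝ) (j : ℕ) (a b c a' b' c' : ℝ) :
    discrepancy τ j (a + a') (b + b') (c + c') =
      discrepancy τ j a b c + discrepancy τ j a' b' c' := by
  induction j generalizing a b c a' b' c' with
  | zero => simp only [discrepancy]; ring
  | succ j ih => simp only [discrepancy, ← ih]; congr 1; ring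

lemma discrepancy_zero (τ : ℝ) (j : ℕ) : discrepancy τ j 0 0 0 = 0 := by
  induction j with
  | zero => simp [discrepancy]
  | succ j ih => simpa [discrepancy] using ih

lemma discrepancy_add_two {α : ℝ} (hα : α ^ 3 = α ^ 2 + 1) (j : ℕ) (a b c : ℝ) :
    discrepancy (α ^ 2 - α) (j + 2) a b c =
      (1 - α) * discrepancy (α ^ 2 - α) (j + 1) a b c
        - (α ^ 2 - α) * discrepancy (α ^ 2 - α) j a b c := by
  induction j generalizing a b c with
  | zero =>
    simp only [discrepancy]
    linear_combination (-α * a - c) * hα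
  | succ j ih => exact ih (a + c) a b

lemma root_bounds {α : ℝ} (hα : α ^ 3 = α ^ 2 + 1) : 1.4655 < α ∧ α < 1.4656 := by
  constructor
  · by_contra! h
    nlinarith [sq_nonneg α, sq_nonneg (α - 1), sq_nonneg (α + 0.3),
      mul_nonneg (sq_nonneg α) (sub_nonneg.2 h)]
  · by_contra! h
    nlinarith [mul_nonneg (sq_nonneg α) (sub_nonneg.2 h)]

lemma inv_root_bounds {α : ℝ} (hα : α ^ 3 = α ^ 2 + 1) :
    0.682 < α ^ 2 - α ∧ α ^ 2 - α < 0.683 := by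
  obtain ⟨h1, h2⟩ := root_bounds hα
  constructor <;> nlinarith

lemma discrepancy_one_quadratic {α : ℝ} (hα : α ^ 3 = α ^ 2 + 1) (j : ℕ) :
    discrepancy (α ^ 2 - α) (j + 1) 1 1 1 ^ 2
      + (α - 1) * discrepancy (α ^ 2 - α) j 1 1 1 * discrepancy (α ^ 2 - α) (j + 1) 1 1 1
      + (α ^ 2 - α) * discrepancy (α ^ 2 - α) j 1 1 1 ^ 2 ≤ 0.1482 * (0.83 ^ j) ^ 2 := by
  obtain ⟨h1, h2⟩ := root_bounds hα
  obtain ⟨h3, h4⟩ := inv_root_bounds hα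
  induction j with
  | zero =>
    have h5 : α ^ 2 - α < 0.6824 := by nlinarith
    have h6 : 0.6821 < α ^ 2 - α := by nlinarith
    simp only [discrepancy]
    generalize α ^ 2 - α = τ at *
    nlinarith [mul_pos (sub_pos.2 h1) (sub_pos.2 h6), mul_pos (sub_pos.2 h5) (sub_pos.2 h6)]
  | succ j ih =>
    rw [discrepancy_add_two hα]
    generalize discrepancy (α ^ 2 - α) (j + 1) 1 1 1 = y at *
    generalize discrepancy (α ^ 2 - α) j 1 1 1 = x at *
    generalize α ^ 2 - α = τ at *
    have h5 : (0 : ℝ) ≤ (0.83 ^ j) ^ 2 := by positivity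
    calc _ = τ * (y ^ 2 + (α - 1) * x * y + τ * x ^ 2) := by ring
      _ ≤ τ * (0.1482 * (0.83 ^ j) ^ 2) := by gcongr
      _ ≤ 0.1482 * (0.83 ^ (j + 1)) ^ 2 := by rw [pow_succ 0.83 j, mul_pow]; nlinarith

lemma abs_discrepancy_one_le {α : ℝ} (hα : α ^ 3 = α ^ 2 + 1) (j : ℕ) :
    |discrepancy (α ^ 2 - α) j 1 1 1| ≤ 0.487 * 0.83 ^ j := by
  obtain ⟨h1, h2⟩ := root_bounds hα
  obtain ⟨h3, -⟩ := inv_root_bounds hα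
  have hQ := discrepancy_one_quadratic hα j
  apply abs_le_of_sq_le_sq _ (by positivity)
  generalize discrepancy (α ^ 2 - α) (j + 1) 1 1 1 = y at *
  generalize discrepancy (α ^ 2 - α) j 1 1 1 = x at *
  generalize α ^ 2 - α = τ at *
  have hτ : 0.6277 ≤ τ - (α - 1) ^ 2 / 4 := by nlinarith
  nlinarith [sq_nonneg (y + (α - 1) / 2 * x), mul_le_mul_of_nonneg_right hτ (sq_nonneg x)]

lemma eq_add_of_apply_succ {H : ℕ → ℕ}
    (hrec : ∀ i : ℕ, 1 ≤ i → H i + H (H (H (i - 1))) = i) {n : ℕ} (h : H (n + 1) = H n + 1) :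
    n = H n + H (H (H n)) := by
  have := hrec (n + 1) (by lia)
  simp only [Nat.add_sub_cancel] at this
  lia

lemma discrepancy_of_apply_succ {H : ℕ → ℕ}
    (hrec : ∀ i : ℕ, 1 ≤ i → H i + H (H (H (i - 1))) = i) (τ : ℝ) (j : ℕ) {n : ℕ}
    (h : H (n + 1) = H n + 1) :
    discrepancy τ j n (H n) (H (H n)) =
      discrepancy τ (j + 1) (H n) (H (H n)) (H (H (H n))) := by
  have e : (n : ℝ) = H n + H (H (H n)) := mod_cast eq_add_of_apply_succ hrec h
  rw [discrepancy, ← e]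

section Sequence

variable {H : ℕ → ℕ} (h0 : H 0 = 0) (hrec : ∀ i : ℕ, 1 ≤ i → H i + H (H (H (i - 1))) = i)
include h0 hrec

lemma apply_le (n : ℕ) : H n ≤ n := by
  rcases Nat.eq_zero_or_pos n with rfl | hn
  · exact h0.le
  · have := hrec n hn
    lia

lemma apply_one : H 1 = 1 := by simpa [h0] using hrec 1 le_rfl

lemma apply_succ (n : ℕ) : H (n + 1) = H n ∨ H (n + 1) = H n + 1 := by
  induction n using Nat.strong_induction_on with
  | _ n ih =>
    rcases n with _ | k
    · simp [h0, apply_one h0 hrec]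
    · have e1 := hrec (k + 1) (by lia)
      have e2 := hrec (k + 2) (by lia)
      simp only [Nat.add_sub_cancel, show k + 2 - 1 = k + 1 by lia] at e1 e2
      have l1 := apply_le h0 hrec k
      have l2 := apply_le h0 hrec (H k)
      rcases ih k (by lia) with h | h
      · rw [h] at e2; rw [h]; lia
      rcases ih (H k) (by lia) with h' | h'
      · rw [h, h'] at e2; lia
      rcases ih (H (H k)) (by lia) with h'' | h'' <;> rw [h, h', h''] at e2 <;> lia

/-- A repeated value of `H` forces three consecutive increments just before it. -/
lemma of_apply_succ_eq {k : ℕ} (h : H (k + 2) = H (k + 1)) :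
    H (k + 1) = H k + 1 ∧ H (H k + 1) = H (H k) + 1 ∧ H (H (H k) + 1) = H (H (H k)) + 1 := by
  have e1 := hrec (k + 1) (by lia)
  have e2 := hrec (k + 2) (by lia)
  simp only [Nat.add_sub_cancel, show k + 2 - 1 = k + 1 by lia] at e1 e2
  rcases apply_succ h0 hrec k with a | a
  · rw [a] at e2; lia
  rcases apply_succ h0 hrec (H k) with b | b
  · rw [a, b] at e2; lia
  rcases apply_succ h0 hrec (H (H k)) with c | c
  · rw [a, b, c] at e2; lia
  exact ⟨a, b, c⟩

lemma discrepancy_of_apply_succ_eq (τ : ℝ) (j : ℕ) {k : ℕ} (h : H (k + 2) = H (k + 1)) :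
    discrepancy τ j (k + 1 : ℕ) (H (k + 1)) (H (H (k + 1))) =
      discrepancy τ (j + 3) (H (H (H k))) (H (H (H (H k)))) (H (H (H (H (H k)))))
        + discrepancy τ j 1 1 1 := by
  obtain ⟨a, b, c⟩ := of_apply_succ_eq h0 hrec h
  rw [← discrepancy_of_apply_succ hrec τ (j + 2) c,
    ← discrepancy_of_apply_succ hrec τ (j + 1) b,
    ← discrepancy_of_apply_succ hrec τ j a, ← discrepancy_add, a, b]
  push_cast
  rfl

lemma abs_discrepancy_le {α : ℝ} (hα : α ^ 3 = α ^ 2 + 1) (n j : ℕ) :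
    |discrepancy (α ^ 2 - α) j n (H n) (H (H n))| ≤ 1.138 * 0.83 ^ j := by
  induction n using Nat.strong_induction_on generalizing j with
  | _ n ih =>
    have hp : (0 : ℝ) < 0.83 ^ j := by positivity
    rcases n with _ | k
    · simp only [h0, Nat.cast_zero, discrepancy_zero, abs_zero]; positivity
    rcases apply_succ h0 hrec (k + 1) with h | h
    · rw [discrepancy_of_apply_succ_eq h0 hrec _ j h]
      have l1 := apply_le h0 hrec k
      have l2 := apply_le h0 hrec (H k)
      have l3 := apply_le h0 hrec (H (H k))
      have b1 := ih (H (H (H k))) (by lia) (j + 3)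
      have b2 := abs_discrepancy_one_le hα j
      refine (abs_add_le _ _).trans ((add_le_add b1 b2).trans ?_)
      rw [pow_add]
      linarith
    · rw [discrepancy_of_apply_succ hrec _ j h]
      have l : H (k + 1) < k + 1 := by
        refine lt_of_le_of_ne (apply_le h0 hrec _) fun e => ?_
        have e' := eq_add_of_apply_succ hrec h
        simp only [e] at e'
        lia
      refine (ih _ l (j + 1)).trans ?_
      rw [pow_succ]
      linarith

lemma abs_sub_mul_lt_one {α : ℝ} (hα : α ^ 3 = α ^ 2 + 1) (n : ℕ) :
    |H n - (α ^ 2 - α) * n| < 1 := by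
  change |discrepancy (α ^ 2 - α) 0 n (H n) (H (H n))| < 1
  rcases apply_succ h0 hrec n with h | h
  · rcases n with _ | k
    · simp [apply_one h0 hrec, h0] at h
    rw [discrepancy_of_apply_succ_eq h0 hrec _ 0 h]
    have b1 := abs_discrepancy_le h0 hrec hα (H (H (H k))) (0 + 3)
    have b2 : |discrepancy (α ^ 2 - α) 0 1 1 1| ≤ 0.318 := by
      obtain ⟨h1, h2⟩ := inv_root_bounds hα
      simp only [discrepancy]
      rw [abs_le]
      constructor <;> linarith
    refine (abs_add_le _ _).trans_lt ((add_le_add b1 b2).trans_lt ?_)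
    norm_num
  · rw [discrepancy_of_apply_succ hrec _ 0 h]
    refine (abs_discrepancy_le h0 hrec hα (H n) (0 + 1)).trans_lt ?_
    norm_num

end Sequence

end HofstadterH

theorem cloitre_conjecture (H : ℕ → ℕ) (h0 : H 0 = 0)
    (hrec : ∀ i : ℕ, 1 ≤ i → H i + H (H (H (i - 1))) = i)
    (α : ℝ) (hα : α ^ 3 = α ^ 2 + 1) :
    ∀ i : ℕ, (H i : ℤ) - ⌊(i : ℝ) / α⌋ = 0 ∨ (H i : ℤ) - ⌊(i : ℝ) / α⌋ = 1 := by
  intro i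
  obtain ⟨hlo, -⟩ := HofstadterH.root_bounds hα
  have hdiv : (i : ℝ) / α = (α ^ 2 - α) * i := by
    rw [div_eq_iff (by linarith)]
    linear_combination -(i : ℝ) * hα
  obtain ⟨h1, h2⟩ := abs_lt.1 (HofstadterH.abs_sub_mul_lt_one h0 hrec hα i)
  have hle : ⌊(i : ℝ) / α⌋ < (H i : ℤ) + 1 := by
    rw [Int.floor_lt, hdiv]
    push_cast
    linarith
  have hge : (H i : ℤ) - 1 ≤ ⌊(i : ℝ) / α⌋ := by
    rw [Int.le_floor, hdiv]
    push_cast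
    linarith
  lia
end
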